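/- There exists a constant C (depending on h, J, α) such that for all N with αN ∈ ℕ, |log Z_N − log Z̃_N| ≤ C·log N, where Z̃_N is obtained from Z_N by replacing, in the combinatorial weight φ_N(D) = N_A!·N_B!/((N_A−2D_A−D_AB)!·(N_B−2D_B−D_AB)!·D_A!·D_B!·D_AB!·2^{D_A}·2^{D_B}), every factorial n! by γ(n). Consequently (1/N)log Z_N = (1/N)log Z̃_N + O(log N / N). -/

import Mathlib

noncomputable section
open Real Matrix Filter Topology

/-- γ(x) = exp(x log x − x); note Real.log 0 = 0 gives γ(0) = 1. -/
def mdGamma (x : ℝ) : ℝ := Real.exp (x * Real.log x - x)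

/-- A monomer-dimer configuration: a set of non-degenerate pairwise disjoint edges. -/
def IsMDConfig (N : ℕ) (Δ : Finset (Sym2 (Fin N))) : Prop :=
  (∀ e ∈ Δ, ¬ e.IsDiag) ∧
    ∀ e ∈ Δ, ∀ e' ∈ Δ, e ≠ e' → ∀ v : Fin N, v ∈ e → v ∉ e'

open scoped Classical in
/-- All monomer-dimer configurations on `N` sites. -/
def mdConfigs (N : ℕ) : Finset (Finset (Sym2 (Fin N))) :=
  Finset.univ.filter fun Δ => IsMDConfig N Δ

open scoped Classical in
/-- Number of dimers internal to population A (sites with index < N_A). -/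
def countA (N NA : ℕ) (Δ : Finset (Sym2 (Fin N))) : ℕ :=
  (Δ.filter fun e => ∀ v : Fin N, v ∈ e → (v : ℕ) < NA).card

open scoped Classical in
/-- Number of dimers internal to population B (sites with index ≥ N_A). -/
def countB (N NA : ℕ) (Δ : Finset (Sym2 (Fin N))) : ℕ :=
  (Δ.filter fun e => ∀ v : Fin N, v ∈ e → NA ≤ (v : ℕ)).card

open scoped Classical in
/-- Number of mixed dimers. -/
def countAB (N NA : ℕ) (Δ : Finset (Sym2 (Fin N))) : ℕ :=
  (Δ.filter fun e =>
    (∃ v : Fin N, v ∈ e ∧ (v : ℕ) < NA) ∧ ∃ v : Fin N, v ∈ e ∧ NA ≤ (v : ℕ)).card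

/-- The dimer numbers of a configuration, as a vector in ℝ³. -/
def dimerVec (N NA : ℕ) (Δ : Finset (Sym2 (Fin N))) : Fin 3 → ℝ :=
  ![ (countA N NA Δ : ℝ), (countB N NA Δ : ℝ), (countAB N NA Δ : ℝ)]

/-- Hamiltonian H_N(D) = −h·D − (1/(2N)) (JD)·D. -/
def mdHamiltonian (N : ℕ) (h : Fin 3 → ℝ) (J : Matrix (Fin 3) (Fin 3) ℝ)
    (D : Fin 3 → ℝ) : ℝ :=
  - (h ⬝ᵥ D) - (1 / (2 * N)) * (J.mulVec D ⬝ᵥ D)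

/-- Partition function Z_N(h, J, α) with N_A = NA. -/
def mdZ (N NA : ℕ) (h : Fin 3 → ℝ) (J : Matrix (Fin 3) (Fin 3) ℝ) : ℝ :=
  ∑ Δ ∈ mdConfigs N,
    ((N : ℝ) ^ (countA N NA Δ + countB N NA Δ + countAB N NA Δ))⁻¹ *
      Real.exp (- mdHamiltonian N h J (dimerVec N NA Δ))

/-- The set of admissible integer dimer-number vectors (D_A, D_B, D_AB). -/
def mdDset (NA NB : ℕ) : Finset (ℕ × ℕ × ℕ) :=
  (Finset.range (NA + 1) ×ˢ Finset.range (NB + 1) ×ˢ Finset.range (NA + NB + 1)).filter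
    fun p => 2 * p.1 + p.2.2 ≤ NA ∧ 2 * p.2.1 + p.2.2 ≤ NB

/-- The combinatorial weight φ_N(D) with every factorial replaced by γ. -/
def phiTilde (NA NB DA DB DAB : ℕ) : ℝ :=
  (mdGamma NA * mdGamma NB) /
    (mdGamma (NA - 2 * DA - DAB) * mdGamma (NB - 2 * DB - DAB) *
      mdGamma DA * mdGamma DB * mdGamma DAB * 2 ^ DA * 2 ^ DB)

/-- The approximated partition function Z̃_N. -/
def mdZtilde (N NA : ℕ) (h : Fin 3 → ℝ) (J : Matrix (Fin 3) (Fin 3) ℝ) : ℝ :=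
  ∑ p ∈ mdDset NA (N - NA),
    phiTilde NA (N - NA) p.1 p.2.1 p.2.2 * ((N : ℝ) ^ (p.1 + p.2.1 + p.2.2))⁻¹ *
      Real.exp (- mdHamiltonian N h J ![ (p.1 : ℝ), (p.2.1 : ℝ), (p.2.2 : ℝ)])

open scoped Classical in
/-- dimers inside the population `p` -/
def cI {N : ℕ} (p : Fin N → Prop) (Δ : Finset (Sym2 (Fin N))) : ℕ :=
  (Δ.filter fun e => ∀ v : Fin N, v ∈ e → p v).card

open scoped Classical in
/-- mixed dimers -/
def cX {N : ℕ} (p : Fin N → Prop) (Δ : Finset (Sym2 (Fin N))) : ℕ :=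
  (Δ.filter fun e => (∃ v : Fin N, v ∈ e ∧ p v) ∧ ∃ v : Fin N, v ∈ e ∧ ¬ p v).card

open scoped Classical in
/-- configurations with given dimer numbers -/
def mS {N : ℕ} (p : Fin N → Prop) (a b c : ℕ) : Finset (Finset (Sym2 (Fin N))) :=
  (mdConfigs N).filter fun Δ => cI p Δ = a ∧ cI (fun v => ¬ p v) Δ = b ∧ cX p Δ = c

lemma mem_mdConfigs {N : ℕ} {Δ : Finset (Sym2 (Fin N))} : Δ ∈ mdConfigs N ↔ IsMDConfig N Δ := by
  simp [mdConfigs]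

lemma mem_mS {N : ℕ} {p : Fin N → Prop} {a b c : ℕ} {Δ : Finset (Sym2 (Fin N))} :
    Δ ∈ mS p a b c ↔ IsMDConfig N Δ ∧ cI p Δ = a ∧ cI (fun v => ¬ p v) Δ = b ∧ cX p Δ = c := by
  simp [mS, mem_mdConfigs]

lemma cI_not_not {N : ℕ} (p : Fin N → Prop) (Δ : Finset (Sym2 (Fin N))) :
    cI (fun v => ¬ ¬ p v) Δ = cI p Δ := by
  simp only [not_not]

lemma cX_not {N : ℕ} (p : Fin N → Prop) (Δ : Finset (Sym2 (Fin N))) :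
    cX (fun v => ¬ p v) Δ = cX p Δ := by
  unfold cX
  congr 1
  ext e
  simp only [not_not, Finset.mem_filter]
  tauto

lemma mS_symm {N : ℕ} (p : Fin N → Prop) (a b c : ℕ) :
    mS (fun v => ¬ p v) b a c = mS p a b c := by
  ext Δ
  rw [mem_mS, mem_mS, cI_not_not, cX_not]
  tauto

open scoped Classical in
lemma edge_card {N : ℕ} (p : Fin N → Prop) (e : Sym2 (Fin N)) (he : ¬ e.IsDiag) :
    (Finset.univ.filter fun v => v ∈ e ∧ p v).card =
      2 * (if ∀ v : Fin N, v ∈ e → p v then 1 else 0) +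
       (if (∃ v : Fin N, v ∈ e ∧ p v) ∧ ∃ v : Fin N, v ∈ e ∧ ¬ p v then 1 else 0) := by
  induction e using Sym2.ind with
  | _ x y =>
    have hxy : x ≠ y := by simpa using he
    by_cases hx : p x <;> by_cases hy : p y
    · have : (Finset.univ.filter fun v => v ∈ s(x, y) ∧ p v) = {x, y} := by
        ext v; simp only [Finset.mem_filter, Finset.mem_univ, true_and, Sym2.mem_iff,
          Finset.mem_insert, Finset.mem_singleton]
        grind
      rw [this, Finset.card_pair hxy]
      simp [hx, hy]
    · have : (Finset.univ.filter fun v => v ∈ s(x, y) ∧ p v) = {x} := by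
        ext v; simp only [Finset.mem_filter, Finset.mem_univ, true_and, Sym2.mem_iff,
          Finset.mem_singleton]
        grind
      rw [this, Finset.card_singleton]
      simp [hx, hy]
    · have : (Finset.univ.filter fun v => v ∈ s(x, y) ∧ p v) = {y} := by
        ext v; simp only [Finset.mem_filter, Finset.mem_univ, true_and, Sym2.mem_iff,
          Finset.mem_singleton]
        grind
      rw [this, Finset.card_singleton]
      simp [hx, hy]
    · have : (Finset.univ.filter fun v => v ∈ s(x, y) ∧ p v) = ∅ := by
        ext v; simp only [Finset.mem_filter, Finset.mem_univ, true_and, Sym2.mem_iff,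
          Finset.notMem_empty]
        grind
      rw [this, Finset.card_empty]
      simp [hx, hy]

open scoped Classical in
/-- size of a population -/
def popV {N : ℕ} (p : Fin N → Prop) : ℕ := (Finset.univ.filter fun v => p v).card

open scoped Classical in
/-- free vertices of population `p` -/
def freeV {N : ℕ} (p : Fin N → Prop) (Δ : Finset (Sym2 (Fin N))) : Finset (Fin N) :=
  Finset.univ.filter fun v => p v ∧ ∀ e ∈ Δ, v ∉ e

open scoped Classical in
lemma free_card {N : ℕ} (p : Fin N → Prop) (Δ : Finset (Sym2 (Fin N))) (hΔ : IsMDConfig N Δ) :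
    2 * cI p Δ + cX p Δ + (freeV p Δ).card = popV p := by
  unfold popV
  have h1 : (Finset.univ.filter fun v => p v) =
      (Δ.biUnion fun e => Finset.univ.filter fun v => v ∈ e ∧ p v) ∪ freeV p Δ := by
    ext v
    simp only [freeV, Finset.mem_filter, Finset.mem_univ, true_and, Finset.mem_union,
      Finset.mem_biUnion]
    grind
  have h2 : Disjoint (Δ.biUnion fun e => Finset.univ.filter fun v => v ∈ e ∧ p v)
      (freeV p Δ) := by
    rw [Finset.disjoint_left]
    intro v
    simp only [freeV, Finset.mem_filter, Finset.mem_univ, true_and, Finset.mem_biUnion]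
    grind
  rw [h1, Finset.card_union_of_disjoint h2, Finset.card_biUnion]
  · rw [Finset.sum_congr rfl (fun e he => edge_card p e (hΔ.1 e he)), Finset.sum_add_distrib,
      ← Finset.mul_sum]
    simp only [cI, cX, Finset.card_filter]
  · intro e he e' he' hne
    simp only [Function.onFun]
    rw [Finset.disjoint_left]
    intro v hv hv'
    simp only [Finset.mem_filter, Finset.mem_univ, true_and] at hv hv'
    exact hΔ.2 e he e' he' hne v hv.1 hv'.1

open scoped Classical in
lemma step_general {N : ℕ} (q : Sym2 (Fin N) → Prop) (m k : ℕ)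
    (S T : Finset (Finset (Sym2 (Fin N))))
    (hS : ∀ Δ ∈ S, IsMDConfig N Δ) (hT : ∀ Δ ∈ T, IsMDConfig N Δ)
    (hST : ∀ Δ e, e ∉ Δ → q e → IsMDConfig N (insert e Δ) → (insert e Δ ∈ T ↔ Δ ∈ S))
    (hm : ∀ Δ ∈ S, (Finset.univ.filter fun e : Sym2 (Fin N) =>
      q e ∧ ¬ e.IsDiag ∧ ∀ v ∈ e, ∀ e' ∈ Δ, v ∉ e').card = m)
    (hk : ∀ Δ ∈ T, (Δ.filter q).card = k) : S.card * m = T.card * k := by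
  apply Finset.card_mul_eq_card_mul (fun Δ' Δ => ∃ e, e ∉ Δ' ∧ q e ∧ insert e Δ' = Δ)
  · intro Δ hΔ
    rw [← hm Δ hΔ]
    symm
    have hnot : ∀ e : Sym2 (Fin N), (∀ v ∈ e, ∀ e' ∈ Δ, v ∉ e') → e ∉ Δ := by
      intro e
      induction e using Sym2.ind with
      | _ x y => intro h h'; exact h x (by simp) _ h' (by simp)
    apply Finset.card_bij (fun e _ => insert e Δ)
    · intro e he
      simp only [Finset.mem_filter, Finset.mem_univ, true_and] at he
      have hn := hnot e he.2.2
      simp only [Finset.bipartiteAbove, Finset.mem_filter]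
      refine ⟨(hST Δ e hn he.1 ?_).2 hΔ, e, hn, he.1, rfl⟩
      obtain ⟨c1, c2⟩ := hS Δ hΔ
      refine ⟨?_, ?_⟩
      · grind
      · intro e1 h1 e2 h2 hne v hv hv'
        rw [Finset.mem_insert] at h1 h2
        rcases h1 with rfl | h1 <;> rcases h2 with rfl | h2
        · exact hne rfl
        · exact he.2.2 v hv _ h2 hv'
        · exact he.2.2 v hv' _ h1 hv
        · exact c2 e1 h1 e2 h2 hne v hv hv'
    · intro e he e' he' heq
      simp only [Finset.mem_filter, Finset.mem_univ, true_and] at he he'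
      have hn := hnot e he.2.2
      have : e ∈ insert e' Δ := by rw [← heq]; simp
      rw [Finset.mem_insert] at this
      tauto
    · intro Δ' h'
      simp only [Finset.bipartiteAbove, Finset.mem_filter] at h'
      obtain ⟨hT', e, hn, hq, rfl⟩ := h'
      refine ⟨e, ?_, rfl⟩
      simp only [Finset.mem_filter, Finset.mem_univ, true_and]
      obtain ⟨c1, c2⟩ := hT _ hT'
      refine ⟨hq, c1 e (by simp), ?_⟩
      intro v hv e' he'
      refine c2 e (by simp) e' (by simp [he']) ?_ v hv
      rintro rfl; exact hn he'
  · intro Δ hΔ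
    rw [← hk Δ hΔ]
    symm
    apply Finset.card_bij (fun e _ => Δ.erase e)
    · intro e he
      rw [Finset.mem_filter] at he
      simp only [Finset.bipartiteBelow, Finset.mem_filter]
      have hi : insert e (Δ.erase e) = Δ := Finset.insert_erase he.1
      refine ⟨?_, e, by simp, he.2, hi⟩
      refine (hST (Δ.erase e) e (by simp) he.2 ?_).1 ?_
      · rw [hi]; exact hT Δ hΔ
      · rw [hi]; exact hΔ
    · intro e he e' he' heq
      rw [Finset.mem_filter] at he he'
      exact Finset.erase_injOn Δ he.1 he'.1 heq
    · intro Δ' h'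
      simp only [Finset.bipartiteBelow, Finset.mem_filter] at h'
      obtain ⟨h1, e, hn, hq, rfl⟩ := h'
      exact ⟨e, by simp [hq], Finset.erase_insert hn⟩

open scoped Classical in
lemma cI_insert {N : ℕ} (p : Fin N → Prop) (Δ : Finset (Sym2 (Fin N))) (e) (he : e ∉ Δ) :
    cI p (insert e Δ) = cI p Δ + if ∀ v : Fin N, v ∈ e → p v then 1 else 0 := by
  unfold cI
  rw [Finset.filter_insert]
  split_ifs
  · rw [Finset.card_insert_of_notMem (by simp [he])]
  · rfl

open scoped Classical in
lemma cX_insert {N : ℕ} (p : Fin N → Prop) (Δ : Finset (Sym2 (Fin N))) (e) (he : e ∉ Δ) :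
    cX p (insert e Δ) = cX p Δ +
      if (∃ v : Fin N, v ∈ e ∧ p v) ∧ ∃ v : Fin N, v ∈ e ∧ ¬ p v then 1 else 0 := by
  unfold cX
  rw [Finset.filter_insert]
  split_ifs
  · rw [Finset.card_insert_of_notMem (by simp [he])]
  · rfl

lemma sym2_exists_mem {N : ℕ} (e : Sym2 (Fin N)) : ∃ v, v ∈ e := by
  induction e using Sym2.ind with
  | _ x y => exact ⟨x, by simp⟩

open scoped Classical in
lemma edgesA_card {N : ℕ} (p : Fin N → Prop) (Δ : Finset (Sym2 (Fin N))) :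
    (Finset.univ.filter fun e : Sym2 (Fin N) =>
      (∀ v, v ∈ e → p v) ∧ ¬ e.IsDiag ∧ ∀ v ∈ e, ∀ e' ∈ Δ, v ∉ e').card =
      (freeV p Δ).card.choose 2 := by
  rw [← Sym2.card_image_offDiag]
  congr 1
  ext e
  induction e using Sym2.ind with
  | _ x y =>
    simp only [Finset.mem_filter, Finset.mem_univ, true_and, Finset.mem_image, Finset.mem_offDiag,
      Prod.exists, freeV, Sym2.mem_iff, Sym2.mk_isDiag_iff]
    constructor
    · intro h
      exact ⟨x, y, by grind, rfl⟩
    · rintro ⟨x', y', h, h'⟩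
      rcases Sym2.eq_iff.1 h' with ⟨rfl, rfl⟩ | ⟨rfl, rfl⟩ <;> grind

open scoped Classical in
lemma edgesX_card {N : ℕ} (p : Fin N → Prop) (Δ : Finset (Sym2 (Fin N))) :
    (Finset.univ.filter fun e : Sym2 (Fin N) =>
      ((∃ v : Fin N, v ∈ e ∧ p v) ∧ ∃ v : Fin N, v ∈ e ∧ ¬ p v) ∧ ¬ e.IsDiag ∧
        ∀ v ∈ e, ∀ e' ∈ Δ, v ∉ e').card =
      (freeV p Δ).card * (freeV (fun v => ¬ p v) Δ).card := by
  rw [← Finset.card_product]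
  symm
  apply Finset.card_bij (fun x _ => s(x.1, x.2))
  · rintro ⟨x, y⟩ h
    simp only [Finset.mem_filter, Finset.mem_univ, true_and, Finset.mem_product, freeV,
      Sym2.mem_iff, Sym2.mk_isDiag_iff] at h ⊢
    grind
  · rintro ⟨x, y⟩ h ⟨x', y'⟩ h' heq
    simp only [Finset.mem_filter, Finset.mem_univ, true_and, Finset.mem_product, freeV] at h h'
    rcases Sym2.eq_iff.1 heq with ⟨h1, h2⟩ | ⟨h1, h2⟩
    · simp_all
    · simp only at h1 h2
      subst h1 h2
      exact absurd h.1.1 h'.2.1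
  · intro e
    induction e using Sym2.ind with
    | _ x y =>
      intro h
      simp only [Finset.mem_filter, Finset.mem_univ, true_and, Sym2.mem_iff,
        Sym2.mk_isDiag_iff] at h
      obtain ⟨⟨⟨u, hu, hpu⟩, w, hw, hpw⟩, hne, hf⟩ := h
      refine ⟨(u, w), ?_, ?_⟩
      · simp only [Finset.mem_filter, Finset.mem_univ, true_and, Finset.mem_product, freeV]
        exact ⟨⟨hpu, hf u hu⟩, hpw, hf w hw⟩
      · rw [Sym2.eq_iff]
        grind

open scoped Classical in
lemma stepA {N : ℕ} (p : Fin N → Prop) (a b c x : ℕ)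
    (hx : 2 * a + c + x = popV p) :
    (mS p a b c).card * x.choose 2 = (mS p (a + 1) b c).card * (a + 1) := by
  apply step_general (fun e => ∀ v, v ∈ e → p v)
  · intro Δ h; exact (mem_mS.1 h).1
  · intro Δ h; exact (mem_mS.1 h).1
  · intro Δ e he hq hc
    obtain ⟨v, hv⟩ := sym2_exists_mem e
    have hc' : IsMDConfig N Δ :=
      ⟨fun e1 h1 => hc.1 e1 (by simp [h1]), fun e1 h1 e2 h2 => hc.2 e1 (by simp [h1]) e2 (by simp [h2])⟩
    rw [mem_mS, mem_mS, cI_insert _ _ _ he, cI_insert _ _ _ he, cX_insert _ _ _ he, if_pos hq,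
      if_neg (fun h => h v hv (hq v hv)), if_neg (by rintro ⟨_, w, hw, hw'⟩; exact hw' (hq w hw))]
    simp [hc, hc']
  · intro Δ h
    rw [mem_mS] at h
    have := free_card p Δ h.1
    have h3 := edgesA_card p Δ
    have h4 : (freeV p Δ).card = x := by omega
    rw [h4] at h3
    convert h3
  · intro Δ h
    rw [mem_mS] at h
    have h3 := h.2.1
    unfold cI at h3
    convert h3

open scoped Classical in
lemma stepX {N : ℕ} (p : Fin N → Prop) (a b c x y : ℕ)
    (hx : 2 * a + c + x = popV p)
    (hy : 2 * b + c + y = popV (fun v => ¬ p v)) :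
    (mS p a b c).card * (x * y) = (mS p a b (c + 1)).card * (c + 1) := by
  apply step_general (fun e => (∃ v : Fin N, v ∈ e ∧ p v) ∧ ∃ v : Fin N, v ∈ e ∧ ¬ p v)
  · intro Δ h; exact (mem_mS.1 h).1
  · intro Δ h; exact (mem_mS.1 h).1
  · intro Δ e he hq hc
    have hc' : IsMDConfig N Δ :=
      ⟨fun e1 h1 => hc.1 e1 (by simp [h1]), fun e1 h1 e2 h2 => hc.2 e1 (by simp [h1]) e2 (by simp [h2])⟩
    rw [mem_mS, mem_mS, cI_insert _ _ _ he, cI_insert _ _ _ he, cX_insert _ _ _ he, if_pos hq,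
      if_neg (by grind), if_neg (by grind)]
    simp [hc, hc']
  · intro Δ h
    rw [mem_mS] at h
    have h1 := free_card p Δ h.1
    have h2 := free_card (fun v => ¬ p v) Δ h.1
    rw [cX_not] at h2
    have h3 := edgesX_card p Δ
    have h4 : (freeV p Δ).card = x := by omega
    have h5 : (freeV (fun v => ¬ p v) Δ).card = y := by omega
    rw [h4, h5] at h3
    convert h3
  · intro Δ h
    rw [mem_mS] at h
    have h3 := h.2.2.2
    unfold cX at h3
    convert h3

lemma mS_zero {N : ℕ} (p : Fin N → Prop) : mS p 0 0 0 = {∅} := by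
  classical
  ext Δ
  rw [mem_mS, Finset.mem_singleton]
  constructor
  · rintro ⟨_, h1, h2, h3⟩
    rw [Finset.eq_empty_iff_forall_notMem]
    intro e he
    simp only [cI, cX, Finset.card_eq_zero, Finset.filter_eq_empty_iff] at h1 h2 h3
    have h1 := h1 he
    have h2 := h2 he
    have h3 := h3 he
    push Not at h1 h2 h3
    grind
  · rintro rfl
    simp [IsMDConfig, cI, cX]

open scoped Nat

open scoped Classical in
lemma mS_card {N : ℕ} (p : Fin N → Prop) (NA NB : ℕ)
    (hA : popV p = NA)
    (hB : popV (fun v => ¬ p v) = NB) (b a c : ℕ) :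
    ∀ x y, 2 * a + c + x = NA → 2 * b + c + y = NB →
      (mS p a b c).card * (x ! * y ! * a ! * b ! * c ! * 2 ^ a * 2 ^ b) = NA ! * NB ! := by
  have hch : ∀ x : ℕ, (x + 2).choose 2 * 2 = (x + 2) * (x + 1) := by
    intro x
    have := Nat.triangle_succ (x + 1)
    rw [Nat.choose_two_right]
    have h2 : 2 ∣ (x + 2) * (x + 1) := by
      rw [mul_comm]; exact (Nat.even_mul_succ_self (x+1)).two_dvd
    exact Nat.div_mul_cancel h2
  induction b with
  | zero =>
    induction a with
    | zero =>
      induction c with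
      | zero =>
        intro x y hx hy
        have hx : x = NA := by omega
        have hy : y = NB := by omega
        subst hx hy
        simp [mS_zero]
      | succ c ih =>
        intro x y hx hy
        have h1 := stepX p 0 0 c (x + 1) (y + 1) (by omega) (by omega)
        rw [← ih (x + 1) (y + 1) (by omega) (by omega)]
        rw [Nat.factorial_succ c, Nat.factorial_succ x, Nat.factorial_succ y]
        zify at h1 ⊢
        simp only [pow_zero, Nat.factorial_zero, Nat.cast_one]
        linear_combination (-1 : ℤ) * (x ! * y ! * c ! : ℤ) * h1
    | succ a ih =>
      intro x y hx hy
      have h1 := stepA p a 0 c (x + 2) (by omega)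
      rw [← ih (x + 2) y (by omega) (by omega)]
      rw [Nat.factorial_succ a, Nat.factorial_succ (x + 1), Nat.factorial_succ x, pow_succ]
      have h2 := hch x
      zify at h1 h2 ⊢
      push_cast
      linear_combination (-2 : ℤ) * (x ! * y ! * a ! * c ! * 2 ^ a : ℤ) * h1 + (mS p a 0 c).card * (x ! * y ! * a ! * c ! * 2 ^ a : ℤ) * h2
  | succ b ih =>
    intro x y hx hy
    have h1 := stepA (fun v => ¬ p v) b a c (y + 2) (by omega)
    rw [mS_symm, mS_symm] at h1
    rw [← ih x (y + 2) (by omega) (by omega)]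
    rw [Nat.factorial_succ b, Nat.factorial_succ (y + 1), Nat.factorial_succ y, pow_succ]
    have h2 := hch y
    zify at h1 h2 ⊢
    push_cast
    linear_combination (-2 : ℤ) * (x ! * y ! * a ! * b ! * c ! * 2 ^ a * 2 ^ b : ℤ) * h1 + (mS p a b c).card * (x ! * y ! * a ! * b ! * c ! * 2 ^ a * 2 ^ b : ℤ) * h2

lemma mdGamma_pos (x : ℝ) : 0 < mdGamma x := Real.exp_pos _

lemma mdGamma_zero : mdGamma 0 = 1 := by simp [mdGamma]

lemma mdGamma_bounds (n : ℕ) : mdGamma ((n + 1 : ℕ) : ℝ) ≤ (n + 1)! ∧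
    ((n + 1)! : ℝ) ≤ Real.exp 1 * (n + 1) * mdGamma ((n + 1 : ℕ) : ℝ) := by
  induction n with
  | zero => simp [mdGamma, ← Real.exp_add]
  | succ n ih =>
    have hp : (0 : ℝ) < n + 1 := by positivity
    have hp2 : (0 : ℝ) < n + 2 := by positivity
    set L := Real.log ((n : ℝ) + 2) - Real.log ((n : ℝ) + 1) with hL
    have hLe : Real.log (((n : ℝ) + 2) / (n + 1)) = L := Real.log_div hp2.ne' hp.ne'
    have hLe' : Real.log (((n : ℝ) + 1) / (n + 2)) = - L := by
      rw [Real.log_div hp.ne' hp2.ne', hL]; ring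
    have hu : ((n : ℝ) + 1) * L ≤ 1 := by
      have := Real.log_le_sub_one_of_pos (div_pos hp2 hp)
      rw [hLe] at this
      have h2 : ((n : ℝ) + 2) / (n + 1) - 1 = 1 / (n + 1) := by field_simp; ring
      rw [h2, le_div_iff₀ hp] at this
      linarith
    have hl : 1 ≤ ((n : ℝ) + 2) * L := by
      have := Real.log_le_sub_one_of_pos (div_pos hp hp2)
      rw [hLe'] at this
      have h2 : ((n : ℝ) + 1) / (n + 2) - 1 = - (1 / (n + 2)) := by field_simp; ring
      rw [h2, neg_le_neg_iff, div_le_iff₀ hp2] at this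
      linarith
    have e1 : mdGamma ((n + 1 + 1 : ℕ) : ℝ) =
        Real.exp (((n : ℝ) + 1) * L - 1) * (n + 2) * mdGamma ((n + 1 : ℕ) : ℝ) := by
      have h3 : (n : ℝ) + 2 = Real.exp (Real.log (n + 2)) := (Real.exp_log hp2).symm
      unfold mdGamma
      conv_rhs => rw [h3, ← Real.exp_add, ← Real.exp_add]
      congr 1
      push_cast
      rw [show (n : ℝ) + 1 + 1 = n + 2 by ring, hL]
      ring
    have e2 : ((n + 1 + 1)! : ℝ) = (n + 2) * (n + 1)! := by
      rw [Nat.factorial_succ (n + 1)]; push_cast; ring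
    have e3 : ((n : ℝ) + 2) = Real.exp L * (n + 1) := by
      rw [hL, Real.exp_sub, Real.exp_log hp2, Real.exp_log hp]; field_simp
    have hg := mdGamma_pos ((n + 1 : ℕ) : ℝ)
    constructor
    · rw [e1, e2]
      have : Real.exp (((n : ℝ) + 1) * L - 1) ≤ 1 := by
        rw [Real.exp_le_one_iff]; linarith
      calc Real.exp (((n : ℝ) + 1) * L - 1) * (n + 2) * mdGamma ((n + 1 : ℕ) : ℝ)
          ≤ 1 * (n + 2) * (n + 1)! := by gcongr; exact ih.1
        _ = _ := by ring
    · rw [e1, e2]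
      have h1 : 1 ≤ Real.exp (((n : ℝ) + 1) * L - 1) * Real.exp L := by
        rw [← Real.exp_add]; apply Real.one_le_exp; linarith
      have h4 : ((n : ℝ) + 1) ≤ Real.exp (((n : ℝ) + 1) * L - 1) * (n + 2) := by
        rw [e3, ← mul_assoc]
        nlinarith
      push_cast
      rw [show (n : ℝ) + 1 + 1 = n + 2 by ring]
      calc ((n : ℝ) + 2) * (n + 1)! ≤ (n + 2) * (Real.exp 1 * (n + 1) * mdGamma ((n + 1 : ℕ) : ℝ)) := by
            gcongr; exact ih.2
        _ ≤ (n + 2) * (Real.exp 1 * (Real.exp (((n : ℝ) + 1) * L - 1) * (n + 2)) *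
              mdGamma ((n + 1 : ℕ) : ℝ)) := by gcongr
        _ = _ := by push_cast; ring

lemma mdGamma_le (n : ℕ) : mdGamma n ≤ n ! := by
  cases n with
  | zero => simp [mdGamma]
  | succ n => exact (mdGamma_bounds n).1

lemma le_mdGamma (N n : ℕ) (hN : 2 ≤ N) (hn : n ≤ N) : (n ! : ℝ) ≤ (N : ℝ) ^ 3 * mdGamma n := by
  have hN' : (2 : ℝ) ≤ N := by exact_mod_cast hN
  cases n with
  | zero =>
    simp only [Nat.factorial_zero, Nat.cast_one, Nat.cast_zero, mdGamma_zero, mul_one]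
    exact one_le_pow₀ (by linarith)
  | succ n =>
    refine (mdGamma_bounds n).2.trans ?_
    have := mdGamma_pos ((n + 1 : ℕ) : ℝ)
    gcongr
    have h1 : (n : ℝ) + 1 ≤ N := by exact_mod_cast hn
    have h2 : Real.exp 1 ≤ (N : ℝ) ^ 2 := by
      have := Real.exp_one_lt_d9
      nlinarith
    calc Real.exp 1 * (n + 1) ≤ (N : ℝ) ^ 2 * N := by gcongr
      _ = _ := by ring

lemma countA_eq (N NA : ℕ) (Δ : Finset (Sym2 (Fin N))) :
    countA N NA Δ = cI (fun v : Fin N => (v : ℕ) < NA) Δ := by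
  unfold countA cI
  congr!

lemma countB_eq (N NA : ℕ) (Δ : Finset (Sym2 (Fin N))) :
    countB N NA Δ = cI (fun v : Fin N => ¬ (v : ℕ) < NA) Δ := by
  unfold countB cI
  simp only [not_lt]

lemma countAB_eq (N NA : ℕ) (Δ : Finset (Sym2 (Fin N))) :
    countAB N NA Δ = cX (fun v : Fin N => (v : ℕ) < NA) Δ := by
  unfold countAB cX
  simp only [not_lt]

lemma popA (N NA : ℕ) (hNA : NA ≤ N) : popV (fun v : Fin N => (v : ℕ) < NA) = NA := by
  unfold popV
  have := Fin.card_filter_val_lt (n := N) (m := NA)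
  rw [min_eq_right hNA] at this
  convert this

lemma popB (N NA : ℕ) (hNA : NA ≤ N) : popV (fun v : Fin N => ¬ (v : ℕ) < NA) = N - NA := by
  classical
  have h1 := popA N NA hNA
  unfold popV at *
  have := Finset.card_filter_add_card_filter_not (s := (Finset.univ : Finset (Fin N)))
    (fun v : Fin N => (v : ℕ) < NA)
  rw [Finset.card_univ, Fintype.card_fin] at this
  have h3 : (Finset.univ.filter (fun v : Fin N => (v : ℕ) < NA)).card = NA := by convert h1
  rw [h3] at this
  have h4 : (Finset.univ.filter (fun v : Fin N => ¬ (v : ℕ) < NA)).card = N - NA := by omega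
  convert h4

/-- Exact partition function as a sum over dimer numbers. -/
lemma mdZ_eq (N NA : ℕ) (hNA : NA ≤ N) (h : Fin 3 → ℝ) (J : Matrix (Fin 3) (Fin 3) ℝ) :
    mdZ N NA h J = ∑ p ∈ mdDset NA (N - NA),
      ((mS (fun v : Fin N => (v : ℕ) < NA) p.1 p.2.1 p.2.2).card : ℝ) *
      (((N : ℝ) ^ (p.1 + p.2.1 + p.2.2))⁻¹ *
      Real.exp (- mdHamiltonian N h J ![ (p.1 : ℝ), (p.2.1 : ℝ), (p.2.2 : ℝ)])) := by
  classical
  unfold mdZ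
  rw [← Finset.sum_fiberwise_of_maps_to (t := mdDset NA (N - NA))
    (g := fun Δ => (countA N NA Δ, countB N NA Δ, countAB N NA Δ))]
  · apply Finset.sum_congr rfl
    rintro ⟨a, b, c⟩ hp
    have : (mdConfigs N).filter (fun Δ => (countA N NA Δ, countB N NA Δ, countAB N NA Δ) = (a, b, c))
        = mS (fun v : Fin N => (v : ℕ) < NA) a b c := by
      ext Δ
      rw [mem_mS, Finset.mem_filter, mem_mdConfigs, countA_eq, countB_eq, countAB_eq]
      simp
    rw [this, ← nsmul_eq_mul]
    apply Finset.sum_eq_card_nsmul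
    intro Δ hΔ
    rw [mem_mS, ← countA_eq, ← countB_eq, ← countAB_eq] at hΔ
    obtain ⟨_, rfl, rfl, rfl⟩ := hΔ
    rfl
  · intro Δ hΔ
    rw [mem_mdConfigs] at hΔ
    have h1 := free_card (fun v : Fin N => (v : ℕ) < NA) Δ hΔ
    have h2 := free_card (fun v : Fin N => ¬ (v : ℕ) < NA) Δ hΔ
    rw [popA N NA hNA, ← countA_eq, ← countAB_eq] at h1
    rw [popB N NA hNA, cX_not, ← countB_eq, ← countAB_eq] at h2
    simp only [mdDset, Finset.mem_filter, Finset.mem_product, Finset.mem_range]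
    omega

lemma phi_bounds (N NA a b c : ℕ) (hN : 2 ≤ N) (hNA : NA ≤ N)
    (ha : 2 * a + c ≤ NA) (hb : 2 * b + c ≤ N - NA) :
    ((mS (fun v : Fin N => (v : ℕ) < NA) a b c).card : ℝ) ≤
      (N : ℝ) ^ 15 * phiTilde NA (N - NA) a b c ∧
    phiTilde NA (N - NA) a b c ≤
      (N : ℝ) ^ 15 * ((mS (fun v : Fin N => (v : ℕ) < NA) a b c).card : ℝ) := by
  obtain ⟨x, hx⟩ := Nat.exists_eq_add_of_le ha
  obtain ⟨y, hy⟩ := Nat.exists_eq_add_of_le hb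
  have key := mS_card (fun v : Fin N => (v : ℕ) < NA) NA (N - NA) (popA N NA hNA)
    (popB N NA hNA) b a c x y hx.symm hy.symm
  set M := (mS (fun v : Fin N => (v : ℕ) < NA) a b c).card
  set NB := N - NA with hNB
  have key' : (M : ℝ) * (x ! * y ! * a ! * b ! * c ! * 2 ^ a * 2 ^ b) = NA ! * NB ! := by
    exact_mod_cast key
  have hN' : (1 : ℝ) ≤ N := by exact_mod_cast (by omega : 1 ≤ N)
  have hxr : (NA : ℝ) - 2 * a - c = x := by rw [hx]; push_cast; ring
  have hyr : (NB : ℝ) - 2 * b - c = y := by rw [hy]; push_cast; ring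
  have gx := mdGamma_pos x
  have gy := mdGamma_pos y
  have ga := mdGamma_pos a
  have gb := mdGamma_pos b
  have gc := mdGamma_pos c
  have gA := mdGamma_pos NA
  have gB := mdGamma_pos NB
  have hM : (M : ℝ) = (NA ! * NB !) / (x ! * y ! * a ! * b ! * c ! * 2 ^ a * 2 ^ b) := by
    rw [eq_div_iff (by positivity)]; exact key'
  unfold phiTilde
  rw [hxr, hyr, hM]
  constructor
  · calc ((NA ! : ℝ) * NB !) / (x ! * y ! * a ! * b ! * c ! * 2 ^ a * 2 ^ b)
        ≤ (((N : ℝ) ^ 3 * mdGamma NA) * ((N : ℝ) ^ 3 * mdGamma NB)) /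
          (mdGamma x * mdGamma y * mdGamma a * mdGamma b * mdGamma c * 2 ^ a * 2 ^ b) := by
          gcongr
          · exact le_mdGamma N NA hN hNA
          · exact le_mdGamma N NB hN (by omega)
          all_goals exact mdGamma_le _
      _ = (N : ℝ) ^ 6 * ((mdGamma NA * mdGamma NB) /
          (mdGamma x * mdGamma y * mdGamma a * mdGamma b * mdGamma c * 2 ^ a * 2 ^ b)) := by ring
      _ ≤ _ := by
          gcongr
          norm_num
  · calc (mdGamma NA * mdGamma NB) /
          (mdGamma x * mdGamma y * mdGamma a * mdGamma b * mdGamma c * 2 ^ a * 2 ^ b)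
        = (N : ℝ) ^ 15 * ((mdGamma NA * mdGamma NB) /
          (((N : ℝ) ^ 3 * mdGamma x) * ((N : ℝ) ^ 3 * mdGamma y) * ((N : ℝ) ^ 3 * mdGamma a) *
            ((N : ℝ) ^ 3 * mdGamma b) * ((N : ℝ) ^ 3 * mdGamma c) * 2 ^ a * 2 ^ b)) := by
          field_simp
      _ ≤ _ := by
          gcongr
          · exact mdGamma_le _
          · exact mdGamma_le _
          all_goals exact le_mdGamma N _ hN (by omega)

lemma main_bound (N NA : ℕ) (hN : 2 ≤ N) (hNA : NA ≤ N) (h : Fin 3 → ℝ)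
    (J : Matrix (Fin 3) (Fin 3) ℝ) :
    |Real.log (mdZ N NA h J) - Real.log (mdZtilde N NA h J)| ≤ 15 * Real.log N := by
  have hN' : (0 : ℝ) < N := by exact_mod_cast (by omega : 0 < N)
  have h1 : mdZ N NA h J ≤ (N : ℝ) ^ 15 * mdZtilde N NA h J := by
    rw [mdZ_eq N NA hNA, mdZtilde, Finset.mul_sum]
    apply Finset.sum_le_sum
    rintro ⟨a, b, c⟩ hp
    simp only [mdDset, Finset.mem_filter] at hp
    have := (phi_bounds N NA a b c hN hNA hp.2.1 hp.2.2).1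
    simp only
    rw [mul_assoc (phiTilde _ _ _ _ _), ← mul_assoc ((N : ℝ) ^ 15)]
    gcongr
  have h2 : mdZtilde N NA h J ≤ (N : ℝ) ^ 15 * mdZ N NA h J := by
    rw [mdZ_eq N NA hNA, mdZtilde, Finset.mul_sum]
    apply Finset.sum_le_sum
    rintro ⟨a, b, c⟩ hp
    simp only [mdDset, Finset.mem_filter] at hp
    have := (phi_bounds N NA a b c hN hNA hp.2.1 hp.2.2).2
    simp only
    rw [mul_assoc (phiTilde _ _ _ _ _), ← mul_assoc ((N : ℝ) ^ 15)]
    gcongr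
  have hpos : 0 < mdZtilde N NA h J := by
    unfold mdZtilde
    apply Finset.sum_pos
    · intro p _
      unfold phiTilde mdGamma
      positivity
    · exact ⟨(0, 0, 0), by simp [mdDset]⟩
  have hpos' : 0 < mdZ N NA h J := by
    have : 0 < (N : ℝ) ^ 15 * mdZ N NA h J := hpos.trans_le h2
    exact (pos_iff_pos_of_mul_pos this).1 (by positivity)
  have l1 := Real.log_le_log hpos' h1
  have l2 := Real.log_le_log hpos h2
  rw [Real.log_mul (by positivity) (by positivity), Real.log_pow] at l1 l2
  push_cast at l1 l2
  rw [abs_le]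
  constructor <;> linarith

theorem stmt3 (α : ℝ) (hα : α ∈ Set.Ioo (0 : ℝ) 1)
    (h : Fin 3 → ℝ) (J : Matrix (Fin 3) (Fin 3) ℝ) :
    ∃ C : ℝ, ∀ N : ℕ, (∃ m : ℕ, (m : ℝ) = α * N) →
      |Real.log (mdZ N ⌊α * N⌋₊ h J) - Real.log (mdZtilde N ⌊α * N⌋₊ h J)| ≤
        C * Real.log N := by
  refine ⟨15, ?_⟩
  rintro N ⟨m, hm⟩
  have hf : ⌊α * N⌋₊ = m := by rw [← hm]; exact Nat.floor_natCast m
  rw [hf]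
  rcases Nat.lt_or_ge N 2 with hN | hN
  · interval_cases N
    · have hm0 : m = 0 := by
        have : (m : ℝ) = 0 := by simpa using hm
        exact_mod_cast this
      subst hm0
      have hZ : mdZtilde 0 0 h J = 1 := by
        have : mdDset 0 (0 - 0) = {(0, 0, 0)} := by decide
        rw [mdZtilde, this]
        simp [phiTilde, mdGamma, mdHamiltonian]
      have hZ' : mdZ 0 0 h J = 1 := by
        rw [mdZ_eq 0 0 le_rfl]
        have : mdDset 0 (0 - 0) = {(0, 0, 0)} := by decide
        rw [this]
        simp [mS_zero, mdHamiltonian]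
      rw [hZ, hZ']
      simp
    · exfalso
      obtain ⟨h0, h1⟩ := hα
      simp only [Nat.cast_one, mul_one] at hm
      rw [← hm] at h0 h1
      have h0' : 0 < m := by exact_mod_cast h0
      have h1' : m < 1 := by exact_mod_cast h1
      omega
  · have hmN : m ≤ N := by
      have : (m : ℝ) ≤ N := by
        rw [hm]
        have : (0 : ℝ) ≤ N := Nat.cast_nonneg N
        nlinarith [hα.2]
      exact_mod_cast this
    exact main_bound N m hN hmN h J
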